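/- Let 0 ≤ p ≤ 1, μ_1, μ_2 ∈ ℝ and σ_1, σ_2 > 0, and let Y_1, …, Y_n be i.i.d. random variables whose common law is the two-component Gaussian mixture with density p·φ_1 + (1−p)·φ_2, where φ_i is the density of N(μ_i, σ_i^2). Let μ = E[Y_1], σ^2 = Var(Y_1) > 0, κ_3 = E[(Y_1 − μ)^3], W = (1/(σ√n))·Σ_{i=1}^n (Y_i − μ), and Z ~ N(0,1). Then there is a constant C, depending only on p, μ_1, σ_1^2, μ_2, σ_2^2 and not on n, such that for every measurable h : ℝ → ℝ with ‖h‖_∞ ≤ 1, |E[h(W)] − E[h(Z)] − (κ_3/(6σ^3√n))·E[(Z^3 − 3Z)·h(Z)]| ≤ C/n. -/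

import Mathlib

open MeasureTheory ProbabilityTheory
open scoped ENNReal

/-- The density of the normal distribution `N(m, s²)`. -/
noncomputable def gaussDensity (m s x : ℝ) : ℝ :=
  (Real.sqrt (2 * Real.pi * s ^ 2))⁻¹ * Real.exp (-(x - m) ^ 2 / (2 * s ^ 2))

open scoped NNReal Polynomial

section GaussianSmoothing

/-- The integral of `h` against the kernel `q φ` centred at `x`, where `φ` is the standard
Gaussian density. -/
noncomputable def gaussSmooth (h : ℝ → ℝ) (q : ℝ[X]) (x : ℝ) : ℝ :=
  ∫ y, h y * (q.eval (y - x) * gaussianPDFReal 0 1 (y - x))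

theorem exists_abs_eval_le_mul_exp (q : ℝ[X]) :
    ∃ C, 0 ≤ C ∧ ∀ u : ℝ, |q.eval u| ≤ C * Real.exp (u ^ 2 / 4) := by
  induction q using Polynomial.induction_on' with
  | add p q hp hq =>
    obtain ⟨C, hC, h⟩ := hp
    obtain ⟨D, hD, h'⟩ := hq
    refine ⟨C + D, add_nonneg hC hD, fun u => ?_⟩
    rw [Polynomial.eval_add, add_mul]
    exact (abs_add_le _ _).trans (add_le_add (h u) (h' u))
  | monomial k a =>
    refine ⟨|a| * (k.factorial * Real.exp 1), by positivity, fun u => ?_⟩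
    rw [Polynomial.eval_monomial, abs_mul, abs_pow, mul_assoc, mul_assoc, ← Real.exp_add]
    gcongr
    have h1 := Real.pow_div_factorial_le_exp |u| (abs_nonneg u) k
    rw [div_le_iff₀ (by positivity)] at h1
    have h2 : Real.exp |u| ≤ Real.exp (1 + u ^ 2 / 4) := by
      gcongr
      nlinarith [sq_nonneg (|u| - 2), sq_abs u]
    nlinarith [show (0 : ℝ) < k.factorial by positivity]

theorem gaussianPDFReal_zero_one (u : ℝ) :
    gaussianPDFReal 0 1 u = (Real.sqrt (2 * Real.pi))⁻¹ * Real.exp (-u ^ 2 / 2) := by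
  simp [gaussianPDFReal]

theorem hasDerivAt_gaussianPDFReal_zero_one (u : ℝ) :
    HasDerivAt (gaussianPDFReal 0 1) (-u * gaussianPDFReal 0 1 u) u := by
  have h : HasDerivAt (fun u : ℝ => (Real.sqrt (2 * Real.pi))⁻¹ * Real.exp (-u ^ 2 / 2))
      ((Real.sqrt (2 * Real.pi))⁻¹ * (Real.exp (-u ^ 2 / 2) * (-(2 * u) / 2))) u := by
    have := (((hasDerivAt_pow 2 u).neg.div_const 2).exp).const_mul (Real.sqrt (2 * Real.pi))⁻¹
    simpa using this
  rw [funext gaussianPDFReal_zero_one]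
  convert h using 1
  ring

theorem exists_abs_eval_mul_gaussianPDFReal_le (q : ℝ[X]) :
    ∃ C, 0 ≤ C ∧ ∀ u : ℝ, |q.eval u * gaussianPDFReal 0 1 u| ≤ C * Real.exp (-u ^ 2 / 4) := by
  obtain ⟨C, hC, h⟩ := exists_abs_eval_le_mul_exp q
  refine ⟨C * (Real.sqrt (2 * Real.pi))⁻¹, by positivity, fun u => ?_⟩
  rw [abs_mul, abs_of_nonneg (gaussianPDFReal_nonneg 0 1 u), gaussianPDFReal_zero_one,
    show -u ^ 2 / 4 = u ^ 2 / 4 + -u ^ 2 / 2 by ring, Real.exp_add]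
  calc _ ≤ (C * Real.exp (u ^ 2 / 4)) * ((Real.sqrt (2 * Real.pi))⁻¹ * Real.exp (-u ^ 2 / 2)) := by
        gcongr; exact h u
    _ = _ := by ring

theorem integrable_gaussSmooth_bound : Integrable (fun u : ℝ => Real.exp (-u ^ 2 / 4)) := by
  convert integrable_exp_neg_mul_sq (b := 1 / 4) (by norm_num) using 2
  ring_nf

theorem abs_mul_eval_mul_le {h : ℝ → ℝ} (h1 : ∀ x, |h x| ≤ 1) {q : ℝ[X]} {C : ℝ}
    (hC : ∀ u : ℝ, |q.eval u * gaussianPDFReal 0 1 u| ≤ C * Real.exp (-u ^ 2 / 4)) (y x : ℝ) :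
    |h y * (q.eval (y - x) * gaussianPDFReal 0 1 (y - x))|
      ≤ C * Real.exp (-(y - x) ^ 2 / 4) := by
  rw [abs_mul]
  calc _ ≤ 1 * |q.eval (y - x) * gaussianPDFReal 0 1 (y - x)| := by gcongr; exact h1 y
    _ ≤ _ := by rw [one_mul]; exact hC _

theorem measurable_gaussSmooth_integrand {h : ℝ → ℝ} (hm : Measurable h) (q : ℝ[X]) (x : ℝ) :
    Measurable fun y => h y * (q.eval (y - x) * gaussianPDFReal 0 1 (y - x)) := by
  have h1 : Measurable fun y : ℝ => q.eval (y - x) :=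
    (q.continuous.comp (continuous_id.sub continuous_const)).measurable
  have h2 : Measurable fun y : ℝ => gaussianPDFReal 0 1 (y - x) :=
    (measurable_gaussianPDFReal 0 1).comp (measurable_id.sub_const x)
  exact hm.mul (h1.mul h2)

theorem integrable_gaussSmooth_integrand {h : ℝ → ℝ} (hm : Measurable h) (h1 : ∀ x, |h x| ≤ 1)
    (q : ℝ[X]) (x : ℝ) :
    Integrable fun y => h y * (q.eval (y - x) * gaussianPDFReal 0 1 (y - x)) := by
  obtain ⟨C, -, hC⟩ := exists_abs_eval_mul_gaussianPDFReal_le q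
  exact ((integrable_gaussSmooth_bound.comp_sub_right x).const_mul C).mono'
    (measurable_gaussSmooth_integrand hm q x).aestronglyMeasurable
    (.of_forall fun y => abs_mul_eval_mul_le h1 hC y x)

theorem exists_abs_gaussSmooth_le (q : ℝ[X]) :
    ∃ B, 0 ≤ B ∧ ∀ h : ℝ → ℝ, (∀ x, |h x| ≤ 1) → ∀ x, |gaussSmooth h q x| ≤ B := by
  obtain ⟨C, hC0, hC⟩ := exists_abs_eval_mul_gaussianPDFReal_le q
  refine ⟨C * ∫ u : ℝ, Real.exp (-u ^ 2 / 4),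
    mul_nonneg hC0 (integral_nonneg fun u => (Real.exp_pos _).le), fun h h1 x => ?_⟩
  rw [← integral_sub_right_eq_self (fun u : ℝ => Real.exp (-u ^ 2 / 4)) x, ← integral_const_mul,
    gaussSmooth]
  exact norm_integral_le_of_norm_le ((integrable_gaussSmooth_bound.comp_sub_right x).const_mul C)
    (.of_forall fun y => (Real.norm_eq_abs _).trans_le (abs_mul_eval_mul_le h1 hC y x))

theorem hasDerivAt_gaussSmooth {h : ℝ → ℝ} (hm : Measurable h) (h1 : ∀ x, |h x| ≤ 1)
    (q : ℝ[X]) (x : ℝ) :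
    HasDerivAt (gaussSmooth h q)
      (gaussSmooth h (Polynomial.X * q - Polynomial.derivative q) x) x := by
  set r := Polynomial.X * q - Polynomial.derivative q with hr
  obtain ⟨C, hC0, hC⟩ := exists_abs_eval_mul_gaussianPDFReal_le r
  refine (hasDerivAt_integral_of_dominated_loc_of_deriv_le (μ := volume)
    (F := fun x y => h y * (q.eval (y - x) * gaussianPDFReal 0 1 (y - x)))
    (F' := fun x y => h y * (r.eval (y - x) * gaussianPDFReal 0 1 (y - x)))
    (bound := fun y => C * Real.exp (1 / 4) * Real.exp (-(1 / 8) * (y - x) ^ 2))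
    (Metric.ball_mem_nhds x one_pos)
    (.of_forall fun x => (measurable_gaussSmooth_integrand hm q x).aestronglyMeasurable)
    (integrable_gaussSmooth_integrand hm h1 q x)
    (measurable_gaussSmooth_integrand hm r x).aestronglyMeasurable
    (.of_forall fun y z hz => (abs_mul_eval_mul_le h1 hC y z).trans ?_) ?_
    (.of_forall fun y z _ => ?_)).2
  · rw [mul_assoc, ← Real.exp_add]
    gcongr
    rw [Metric.mem_ball, Real.dist_eq, abs_lt] at hz
    nlinarith [sq_nonneg (y - z - (z - x)), hz.1, hz.2]
  · exact ((integrable_exp_neg_mul_sq (b := 1 / 8) (by norm_num)).comp_sub_right x).const_mul _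
  · have hs : HasDerivAt (fun z : ℝ => y - z) (-1) z := (hasDerivAt_id z).const_sub y
    have := (((q.hasDerivAt (y - z)).comp z hs).mul
      ((hasDerivAt_gaussianPDFReal_zero_one (y - z)).comp z hs)).const_mul (h y)
    refine HasDerivAt.congr_deriv (f := fun x => h y * (q.eval (y - x) *
      gaussianPDFReal 0 1 (y - x))) this ?_
    simp only [hr, Polynomial.eval_sub, Polynomial.eval_mul, Polynomial.eval_X,
      Function.comp_apply]
    ring

/-- The probabilists' Hermite polynomials with real coefficients. -/
noncomputable def realHermite (j : ℕ) : ℝ[X] := (Polynomial.hermite j).map (Int.castRingHom ℝ)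

theorem realHermite_succ (j : ℕ) :
    realHermite (j + 1)
      = Polynomial.X * realHermite j - Polynomial.derivative (realHermite j) := by
  simp [realHermite, Polynomial.hermite_succ, Polynomial.derivative_map]

theorem realHermite_zero : realHermite 0 = 1 := by simp [realHermite]

theorem eval_realHermite_three (u : ℝ) : (realHermite 3).eval u = u ^ 3 - 3 * u := by
  simp [realHermite_succ, realHermite_zero]
  ring

theorem integral_gaussianReal_zero_one (f : ℝ → ℝ) :
    ∫ z, f z ∂gaussianReal 0 1 = ∫ z, gaussianPDFReal 0 1 z * f z := by
  simp [integral_gaussianReal_eq_integral_smul one_ne_zero]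

theorem gaussSmooth_one (h : ℝ → ℝ) (x : ℝ) :
    gaussSmooth h 1 x = ∫ u, h (x + u) ∂gaussianReal 0 1 := by
  rw [integral_gaussianReal_zero_one, gaussSmooth,
    ← integral_add_left_eq_self _ x]
  simp [mul_comm]

theorem gaussSmooth_zero_right (h : ℝ → ℝ) (q : ℝ[X]) :
    gaussSmooth h q 0 = ∫ z, q.eval z * h z ∂gaussianReal 0 1 := by
  rw [integral_gaussianReal_zero_one, gaussSmooth]
  congr 1 with y
  simp only [sub_zero]
  ring

end GaussianSmoothing

section Lindeberg

theorem abs_taylor_remainder_le {D : ℕ → ℝ → ℝ} {M : ℝ} (k : ℕ)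
    (hD : ∀ j x, HasDerivAt (D j) (D (j + 1) x) x) (hM : ∀ x, |D k x| ≤ M) (x t : ℝ) :
    |D 0 (x + t) - ∑ j ∈ Finset.range k, t ^ j / j.factorial * D j x| ≤ M * |t| ^ k := by
  induction k generalizing D t with
  | zero => simpa using hM (x + t)
  | succ k ih =>
    set r : ℝ → ℝ :=
      fun t => D 0 (x + t) - ∑ j ∈ Finset.range (k + 1), t ^ j / j.factorial * D j x with hr
    set r' : ℝ → ℝ :=
      fun t => D 1 (x + t) - ∑ j ∈ Finset.range k, t ^ j / j.factorial * D (j + 1) x with hr'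
    have hM0 : 0 ≤ M := (abs_nonneg _).trans (hM 0)
    have hder : ∀ t, HasDerivAt r (r' t) t := by
      intro t
      have hsum : HasDerivAt (fun t => ∑ j ∈ Finset.range (k + 1), t ^ j / j.factorial * D j x)
          (∑ j ∈ Finset.range (k + 1), (j * t ^ (j - 1)) / j.factorial * D j x) t :=
        HasDerivAt.fun_sum fun j _ =>
          ((hasDerivAt_pow j t).div_const _).mul_const _
      have h0 : HasDerivAt (fun t => D 0 (x + t)) (D 1 (x + t)) t :=
        (hD 0 (x + t)).comp_const_add x t
      refine (h0.sub hsum).congr_deriv ?_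
      rw [hr', Finset.sum_range_succ']
      simp only [CharP.cast_eq_zero, zero_mul, zero_div, add_zero, Nat.add_sub_cancel]
      congr 1
      refine Finset.sum_congr rfl fun j _ => ?_
      rw [Nat.factorial_succ]
      push_cast
      field_simp
    have hb : ∀ u, |r' u| ≤ M * |u| ^ k := fun u =>
      ih (D := fun j => D (j + 1)) (fun j => hD (j + 1)) hM u
    have h0 : r 0 = 0 := by
      simp [hr, Finset.sum_range_succ']
    have := Convex.norm_image_sub_le_of_norm_hasDerivWithin_le (s := Set.uIcc 0 t) (f := r)
      (f' := r') (x := 0) (y := t) (C := M * |t| ^ k)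
      (fun u _ => (hder u).hasDerivWithinAt)
      (fun u hu => (hb u).trans <|
        mul_le_mul_of_nonneg_left (pow_le_pow_left₀ (abs_nonneg u)
          (by simpa only [sub_zero] using Set.abs_sub_left_of_mem_uIcc hu) k) hM0)
      (convex_uIcc 0 t) Set.left_mem_uIcc Set.right_mem_uIcc
    rw [h0, sub_zero, sub_zero, Real.norm_eq_abs, Real.norm_eq_abs] at this
    rw [pow_succ, ← mul_assoc]
    exact this

theorem integrable_of_continuous_of_abs_le {f : ℝ → ℝ} {M : ℝ} (hf : Continuous f)
    (hM : ∀ x, |f x| ≤ M) (μ : Measure ℝ) [IsFiniteMeasure μ] : Integrable f μ :=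
  (integrable_const M).mono' hf.aestronglyMeasurable (.of_forall hM)

theorem integrable_integral_of_conv {f : ℝ → ℝ} {μ ν : Measure ℝ} [SFinite μ] [SFinite ν]
    (hf : Integrable f (μ ∗ ν)) : Integrable (fun x => ∫ y, f (x + y) ∂ν) μ := by
  rw [Measure.conv, integrable_map_measure hf.1 (by fun_prop)] at hf
  exact hf.integral_prod_left

theorem integrable_abs_pow {α : Measure ℝ} (hα : ∀ k : ℕ, Integrable (fun x => x ^ k) α) (k : ℕ) :
    Integrable (fun x => |x| ^ k) α := by
  simpa [abs_pow] using (hα k).abs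

theorem abs_integral_conv_taylor_le {α lam : Measure ℝ} [IsProbabilityMeasure α]
    [IsProbabilityMeasure lam] (hα : ∀ k : ℕ, Integrable (fun x => x ^ k) α)
    {D : ℕ → ℝ → ℝ} {M : ℕ → ℝ} (hD : ∀ j x, HasDerivAt (D j) (D (j + 1) x) x)
    (hM : ∀ j x, |D j x| ≤ M j) (k : ℕ) :
    |∫ x, D 0 x ∂(lam ∗ α)
        - ∑ j ∈ Finset.range k, (∫ t, t ^ j ∂α) / j.factorial * ∫ x, D j x ∂lam|
      ≤ M k * ∫ t, |t| ^ k ∂α := by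
  have hc : ∀ j, Continuous (D j) := fun j =>
    continuous_iff_continuousAt.2 fun x => (hD j x).continuousAt
  have hi : ∀ j (ρ : Measure ℝ) [IsProbabilityMeasure ρ], Integrable (D j) ρ := fun j ρ _ =>
    integrable_of_continuous_of_abs_le (hc j) (hM j) ρ
  have hint : ∀ x, Integrable (fun t => D 0 (x + t)) α := fun x =>
    integrable_of_continuous_of_abs_le ((hc 0).comp (continuous_const_add x))
      (fun t => hM 0 (x + t)) α
  have hterm : ∀ x, ∀ j ∈ Finset.range k,
      Integrable (fun t : ℝ => t ^ j / j.factorial * D j x) α :=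
    fun x j _ => ((hα j).div_const _).mul_const _
  have hinner : ∀ x, |∫ t, D 0 (x + t) ∂α
      - ∑ j ∈ Finset.range k, (∫ t, t ^ j ∂α) / j.factorial * D j x|
      ≤ M k * ∫ t, |t| ^ k ∂α := by
    intro x
    have heq : ∫ t, D 0 (x + t) ∂α
        - ∑ j ∈ Finset.range k, (∫ t, t ^ j ∂α) / j.factorial * D j x
        = ∫ t, (D 0 (x + t) - ∑ j ∈ Finset.range k, t ^ j / j.factorial * D j x) ∂α := by
      rw [integral_sub (hint x) (integrable_finsetSum _ (hterm x)),
        integral_finsetSum _ (hterm x)]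
      simp [integral_mul_const, integral_div]
    rw [heq, ← integral_const_mul]
    exact norm_integral_le_of_norm_le ((integrable_abs_pow hα k).const_mul _)
      (.of_forall fun t =>
        (Real.norm_eq_abs _).trans_le (abs_taylor_remainder_le k hD (hM k) x t))
  have hsum : ∀ j ∈ Finset.range k,
      Integrable (fun x => (∫ t, t ^ j ∂α) / j.factorial * D j x) lam :=
    fun j _ => (hi j lam).const_mul _
  have hconv := hi 0 (lam ∗ α)
  have heq : ∫ x, D 0 x ∂(lam ∗ α)
        - ∑ j ∈ Finset.range k, (∫ t, t ^ j ∂α) / j.factorial * ∫ x, D j x ∂lam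
      = ∫ x, (∫ t, D 0 (x + t) ∂α
        - ∑ j ∈ Finset.range k, (∫ t, t ^ j ∂α) / j.factorial * D j x) ∂lam := by
    rw [integral_conv hconv, integral_sub _ (integrable_finsetSum _ hsum),
      integral_finsetSum _ hsum]
    · simp [integral_const_mul]
    · exact integrable_integral_of_conv hconv
  rw [heq]
  have := norm_integral_le_of_norm_le_const (μ := lam)
    (.of_forall fun x => (Real.norm_eq_abs _).trans_le (hinner x))
  simpa using this

/-- The `n`-fold convolution power of a measure on the real line. -/
noncomputable def convPow (α : Measure ℝ) : ℕ → Measure ℝ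
  | 0 => Measure.dirac 0
  | n + 1 => convPow α n ∗ α

instance isProbabilityMeasure_convPow (α : Measure ℝ) [IsProbabilityMeasure α] (n : ℕ) :
    IsProbabilityMeasure (convPow α n) := by
  induction n with
  | zero => rw [convPow]; infer_instance
  | succ n ih => rw [convPow]; infer_instance

theorem charFun_convPow (α : Measure ℝ) [IsProbabilityMeasure α] (n : ℕ) (t : ℝ) :
    charFun (convPow α n) t = charFun α t ^ n := by
  induction n with
  | zero => simp [convPow]
  | succ n ih => rw [convPow, charFun_conv, ih, pow_succ]

theorem convPow_succ_conv_convPow (α β : Measure ℝ) [IsProbabilityMeasure α]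
    [IsProbabilityMeasure β] (k l : ℕ) :
    convPow α (k + 1) ∗ convPow β l = (convPow α k ∗ convPow β l) ∗ α := by
  rw [convPow, Measure.conv_assoc, Measure.conv_comm α, ← Measure.conv_assoc]

theorem convPow_conv_convPow_succ (α β : Measure ℝ) [IsProbabilityMeasure α]
    [IsProbabilityMeasure β] (k l : ℕ) :
    convPow α k ∗ convPow β (l + 1) = (convPow α k ∗ convPow β l) ∗ β := by
  rw [convPow, ← Measure.conv_assoc]

section Exchange

variable {α β : Measure ℝ} [IsProbabilityMeasure α] [IsProbabilityMeasure β]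
  {D : ℕ → ℝ → ℝ} {M : ℕ → ℝ}

theorem abs_integral_conv_sub_integral_conv_sub_le {lam : Measure ℝ} [IsProbabilityMeasure lam]
    (hα : ∀ k : ℕ, Integrable (fun x => x ^ k) α) (hβ : ∀ k : ℕ, Integrable (fun x => x ^ k) β)
    (h1 : ∫ x, x ∂α = ∫ x, x ∂β) (h2 : ∫ x, x ^ 2 ∂α = ∫ x, x ^ 2 ∂β)
    (hβ3 : ∫ x, x ^ 3 ∂β = 0) (hD : ∀ j x, HasDerivAt (D j) (D (j + 1) x) x)
    (hM : ∀ j x, |D j x| ≤ M j) :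
    |∫ x, D 0 x ∂(lam ∗ α) - ∫ x, D 0 x ∂(lam ∗ β) - (∫ x, x ^ 3 ∂α) / 6 * ∫ x, D 3 x ∂lam|
      ≤ M 4 * (∫ x, |x| ^ 4 ∂α + ∫ x, |x| ^ 4 ∂β) := by
  have ha := abs_integral_conv_taylor_le (lam := lam) hα hD hM 4
  have hb := abs_integral_conv_taylor_le (lam := lam) hβ hD hM 4
  simp only [Finset.sum_range_succ, Finset.sum_range_zero, pow_one, h1, h2, hβ3] at ha hb
  simp only [Nat.factorial, Nat.cast_ofNat, Nat.succ_eq_add_one, Nat.reduceAdd, Nat.reduceMul,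
    pow_zero, integral_const, probReal_univ] at ha hb
  rw [abs_le] at *
  constructor <;> linarith [ha.1, ha.2, hb.1, hb.2]

theorem abs_integral_conv_sub_integral_conv_le {lam : Measure ℝ} [IsProbabilityMeasure lam]
    (hα : ∀ k : ℕ, Integrable (fun x => x ^ k) α) (hβ : ∀ k : ℕ, Integrable (fun x => x ^ k) β)
    (h1 : ∫ x, x ∂α = ∫ x, x ∂β) (h2 : ∫ x, x ^ 2 ∂α = ∫ x, x ^ 2 ∂β)
    (hD : ∀ j x, HasDerivAt (D j) (D (j + 1) x) x) (hM : ∀ j x, |D j x| ≤ M j) :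
    |∫ x, D 0 x ∂(lam ∗ α) - ∫ x, D 0 x ∂(lam ∗ β)|
      ≤ M 3 * (∫ x, |x| ^ 3 ∂α + ∫ x, |x| ^ 3 ∂β) := by
  have ha := abs_integral_conv_taylor_le (lam := lam) hα hD hM 3
  have hb := abs_integral_conv_taylor_le (lam := lam) hβ hD hM 3
  simp only [Finset.sum_range_succ, Finset.sum_range_zero, pow_one, h1, h2] at ha hb
  simp only [pow_zero, integral_const, probReal_univ] at ha hb
  rw [abs_le] at *
  constructor <;> linarith [ha.1, ha.2, hb.1, hb.2]

theorem abs_integral_convPow_conv_sub_le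
    (hα : ∀ k : ℕ, Integrable (fun x => x ^ k) α) (hβ : ∀ k : ℕ, Integrable (fun x => x ^ k) β)
    (h1 : ∫ x, x ∂α = ∫ x, x ∂β) (h2 : ∫ x, x ^ 2 ∂α = ∫ x, x ^ 2 ∂β)
    (hD : ∀ j x, HasDerivAt (D j) (D (j + 1) x) x) (hM : ∀ j x, |D j x| ≤ M j) (k l : ℕ) :
    |∫ x, D 0 x ∂(convPow α k ∗ convPow β l) - ∫ x, D 0 x ∂(convPow β (k + l))|
      ≤ k * (M 3 * (∫ x, |x| ^ 3 ∂α + ∫ x, |x| ^ 3 ∂β)) := by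
  induction k generalizing l with
  | zero => simp [convPow]
  | succ k ih =>
    have h := abs_integral_conv_sub_integral_conv_le (lam := convPow α k ∗ convPow β l)
      hα hβ h1 h2 hD hM
    rw [← convPow_succ_conv_convPow, ← convPow_conv_convPow_succ] at h
    have h' := ih (l + 1)
    rw [show k + (l + 1) = k + 1 + l by ring] at h'
    push_cast
    rw [abs_le] at *
    constructor <;> linarith [h.1, h.2, h'.1, h'.2]

theorem abs_integral_convPow_conv_sub_succ_le
    (hα : ∀ k : ℕ, Integrable (fun x => x ^ k) α) (hβ : ∀ k : ℕ, Integrable (fun x => x ^ k) β)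
    (h1 : ∫ x, x ∂α = ∫ x, x ∂β) (h2 : ∫ x, x ^ 2 ∂α = ∫ x, x ^ 2 ∂β)
    (hD : ∀ j x, HasDerivAt (D j) (D (j + 1) x) x) (hM : ∀ j x, |D j x| ≤ M j) (k l : ℕ) :
    |∫ x, D 0 x ∂(convPow α k ∗ convPow β l) - ∫ x, D 0 x ∂(convPow β (k + 1 + l))|
      ≤ k * (M 3 * (∫ x, |x| ^ 3 ∂α + ∫ x, |x| ^ 3 ∂β)) + M 1 * ∫ x, |x| ∂β := by
  have h := abs_integral_conv_taylor_le (lam := convPow β (k + l)) hβ hD hM 1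
  rw [show k + 1 + l = k + l + 1 by ring, convPow]
  have h' := abs_integral_convPow_conv_sub_le hα hβ h1 h2 hD hM k l
  simp only [Finset.sum_range_succ, Finset.sum_range_zero, pow_one, pow_zero, integral_const,
    probReal_univ, Nat.factorial, Nat.cast_one, div_one, smul_eq_mul, one_mul, zero_add] at h
  rw [abs_le] at *
  constructor <;> linarith [h.1, h.2, h'.1, h'.2]

theorem abs_integral_convPow_conv_sub_sub_le
    (hα : ∀ k : ℕ, Integrable (fun x => x ^ k) α) (hβ : ∀ k : ℕ, Integrable (fun x => x ^ k) β)
    (h1 : ∫ x, x ∂α = ∫ x, x ∂β) (h2 : ∫ x, x ^ 2 ∂α = ∫ x, x ^ 2 ∂β)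
    (hβ3 : ∫ x, x ^ 3 ∂β = 0) (hD : ∀ j x, HasDerivAt (D j) (D (j + 1) x) x)
    (hM : ∀ j x, |D j x| ≤ M j) (k l : ℕ) :
    |∫ x, D 0 x ∂(convPow α k ∗ convPow β l) - ∫ x, D 0 x ∂(convPow β (k + l))
        - k * ((∫ x, x ^ 3 ∂α) / 6 * ∫ x, D 3 x ∂(convPow β (k + l)))|
      ≤ k * (M 4 * (∫ x, |x| ^ 4 ∂α + ∫ x, |x| ^ 4 ∂β)
        + |(∫ x, x ^ 3 ∂α) / 6| * ((k + l : ℕ) * (M 6 * (∫ x, |x| ^ 3 ∂α + ∫ x, |x| ^ 3 ∂β))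
          + M 4 * ∫ x, |x| ∂β)) := by
  induction k generalizing l with
  | zero => simp [convPow]
  | succ k ih =>
    have h := abs_integral_conv_sub_integral_conv_sub_le (lam := convPow α k ∗ convPow β l)
      hα hβ h1 h2 hβ3 hD hM
    rw [← convPow_succ_conv_convPow, ← convPow_conv_convPow_succ] at h
    have h' := ih (l + 1)
    rw [show k + (l + 1) = k + 1 + l by ring] at h'
    have h3 := abs_integral_convPow_conv_sub_succ_le (D := fun j => D (j + 3))
      (M := fun j => M (j + 3)) hα hβ h1 h2 (fun j => hD (j + 3)) (fun j => hM (j + 3)) k l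
    simp only [zero_add, Nat.reduceAdd] at h3
    have hM6 : 0 ≤ M 6 * (∫ x, |x| ^ 3 ∂α + ∫ x, |x| ^ 3 ∂β) :=
      mul_nonneg ((abs_nonneg _).trans (hM 6 0)) (add_nonneg
        (integral_nonneg fun x => by positivity) (integral_nonneg fun x => by positivity))
    have hk : (k : ℝ) ≤ (k + 1 + l : ℕ) := by norm_cast; lia
    have h4 := mul_le_mul_of_nonneg_left (h3.trans (add_le_add_left
      (mul_le_mul_of_nonneg_right hk hM6) _)) (abs_nonneg ((∫ x, x ^ 3 ∂α) / 6))
    rw [← abs_mul] at h4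
    rw [show ((k + 1 : ℕ) : ℝ) = k + 1 by push_cast; rfl]
    rw [abs_le] at h h' h4 ⊢
    constructor <;> linarith [h.1, h.2, h'.1, h'.2, h4.1, h4.2]

end Exchange

end Lindeberg

section Gaussian

theorem integrable_sub_pow_gaussianReal (c μ : ℝ) (v : ℝ≥0) (k : ℕ) :
    Integrable (fun x => (x - c) ^ k) (gaussianReal μ v) := by
  have h : MemLp (fun x : ℝ => x - c) (k : ℝ≥0) (gaussianReal μ v) :=
    (memLp_id_gaussianReal (k : ℝ≥0)).sub (memLp_const c)
  refine (integrable_norm_iff (by fun_prop)).1 ?_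
  simp_rw [norm_pow]
  exact h.integrable_norm_pow'

theorem integrable_pow_gaussianReal (μ : ℝ) (v : ℝ≥0) (k : ℕ) :
    Integrable (fun x => x ^ k) (gaussianReal μ v) := by
  simpa using integrable_sub_pow_gaussianReal 0 μ v k

theorem integral_sub_gaussianReal (μ : ℝ) (v : ℝ≥0) : ∫ x, (x - μ) ∂gaussianReal μ v = 0 := by
  have h : Integrable (fun x : ℝ => x) (gaussianReal μ v) := by
    simpa using integrable_pow_gaussianReal μ v 1
  rw [integral_sub h (integrable_const _), integral_id_gaussianReal]
  simp

theorem integral_sub_sq_gaussianReal (μ : ℝ) (v : ℝ≥0) :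
    ∫ x, (x - μ) ^ 2 ∂gaussianReal μ v = v := by
  rw [← variance_fun_id_gaussianReal (μ := μ) (v := v), variance_eq_integral (by fun_prop),
    integral_id_gaussianReal]

theorem integral_sub_cube_gaussianReal (μ : ℝ) (v : ℝ≥0) :
    ∫ x, (x - μ) ^ 3 ∂gaussianReal μ v = 0 := by
  have h : ∫ x, (x - μ) ^ 3 ∂gaussianReal μ v = ∫ x, x ^ 3 ∂gaussianReal 0 v := by
    rw [← sub_self μ, ← gaussianReal_map_sub_const μ, integral_map (by fun_prop) (by fun_prop)]
  have h' : ∫ x, x ^ 3 ∂gaussianReal 0 v = -∫ x, x ^ 3 ∂gaussianReal 0 v := by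
    conv_lhs => rw [← neg_zero, ← gaussianReal_map_neg,
      integral_map (by fun_prop) (by fun_prop)]
    rw [← integral_neg]
    congr 1 with x
    ring
  rw [h]
  linarith

theorem convPow_gaussianReal (w : ℝ≥0) (n : ℕ) :
    convPow (gaussianReal 0 w) n = gaussianReal 0 (n * w) := by
  induction n with
  | zero => simp [convPow, gaussianReal_zero_var]
  | succ n ih =>
    rw [convPow, ih, gaussianReal_conv_gaussianReal]
    simp [add_mul]

theorem integral_gaussianReal_sq {F : ℝ → ℝ} (hF : Measurable F) {a : ℝ} {v : ℝ≥0}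
    (hv : (v : ℝ) = a ^ 2) :
    ∫ y, F y ∂gaussianReal 0 v = ∫ u, F (a * u) ∂gaussianReal 0 1 := by
  have h : (gaussianReal 0 1).map (a * ·) = gaussianReal 0 v := by
    rw [gaussianReal_map_const_mul]
    congr 1
    · simp
    · ext; simp [hv]
  rw [← h, integral_map (by fun_prop) hF.aestronglyMeasurable]

theorem map_sum_pi_conv_gaussianReal (α : Measure ℝ) [IsProbabilityMeasure α] (m : ℝ) (v : ℝ≥0)
    (n : ℕ) :
    (Measure.pi fun _ : Fin n => α ∗ gaussianReal m v).map (fun ω => ∑ i, ω i)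
      = convPow α n ∗ gaussianReal (n * m) (n * v) := by
  have : IsProbabilityMeasure
      ((Measure.pi fun _ : Fin n => α ∗ gaussianReal m v).map (fun ω => ∑ i, ω i)) :=
    Measure.isProbabilityMeasure_map (by fun_prop)
  apply Measure.ext_of_charFun
  ext t
  rw [charFun_map_sum_pi_eq_prod, charFun_conv, charFun_convPow]
  simp only [Finset.prod_apply, charFun_conv, charFun_gaussianReal, Finset.prod_const,
    Finset.card_univ, Fintype.card_fin, mul_pow, ← Complex.exp_nat_mul]
  congr 2
  push_cast
  ring

end Gaussian

section ScaledSmoothing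

/-- The `j`-th derivative of the convolution of `h` with the centred Gaussian law of standard
deviation `a`. -/
noncomputable def scaledSmooth (h : ℝ → ℝ) (a : ℝ) (j : ℕ) (x : ℝ) : ℝ :=
  gaussSmooth (fun t => h (a * t)) (realHermite j) (x / a) / a ^ j

variable {h : ℝ → ℝ}

theorem hasDerivAt_scaledSmooth (hm : Measurable h) (h1 : ∀ x, |h x| ≤ 1) (a : ℝ) (j : ℕ)
    (x : ℝ) : HasDerivAt (scaledSmooth h a j) (scaledSmooth h a (j + 1) x) x := by
  have hd := hasDerivAt_gaussSmooth (h := fun t => h (a * t)) (hm.comp (measurable_const_mul a))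
    (fun t => h1 _) (realHermite j) (x / a)
  rw [← realHermite_succ] at hd
  refine ((hd.comp x ((hasDerivAt_id x).div_const a)).div_const (a ^ j)).congr_deriv ?_
  rw [scaledSmooth, pow_succ', mul_one_div, div_div]

theorem exists_abs_scaledSmooth_le (j : ℕ) :
    ∃ B, ∀ h : ℝ → ℝ, (∀ x, |h x| ≤ 1) → ∀ a, 0 < a → ∀ x,
      |scaledSmooth h a j x| ≤ B / a ^ j := by
  obtain ⟨B, -, hB⟩ := exists_abs_gaussSmooth_le (realHermite j)
  refine ⟨B, fun h h1 a ha x => ?_⟩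
  rw [scaledSmooth, abs_div, abs_of_pos (pow_pos ha j)]
  gcongr
  exact hB _ (fun t => h1 _) _

theorem scaledSmooth_zero (hm : Measurable h) {a : ℝ} (ha : 0 < a) {v : ℝ≥0}
    (hv : (v : ℝ) = a ^ 2) (x : ℝ) :
    scaledSmooth h a 0 x = ∫ y, h (x + y) ∂gaussianReal 0 v := by
  rw [integral_gaussianReal_sq (F := fun y => h (x + y)) (hm.comp (measurable_const_add x)) hv,
    scaledSmooth,
    realHermite_zero, gaussSmooth_one, pow_zero, div_one]
  simp_rw [mul_add, mul_div_cancel₀ _ ha.ne']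

theorem integrable_of_measurable_of_abs_le_one (hm : Measurable h) (h1 : ∀ x, |h x| ≤ 1)
    (μ : Measure ℝ) [IsFiniteMeasure μ] : Integrable h μ :=
  (integrable_const 1).mono' hm.aestronglyMeasurable (.of_forall h1)

theorem integral_scaledSmooth_add (hm : Measurable h) (h1 : ∀ x, |h x| ≤ 1) {a b : ℝ}
    (ha : 0 < a) (hb : 0 < b) {w : ℝ≥0} (hw : (w : ℝ) + a ^ 2 = b ^ 2) (j : ℕ) (x : ℝ) :
    ∫ u, scaledSmooth h a j (x + u) ∂gaussianReal 0 w = scaledSmooth h b j x := by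
  obtain ⟨v, hv⟩ : ∃ v : ℝ≥0, (v : ℝ) = a ^ 2 := ⟨⟨a ^ 2, sq_nonneg a⟩, rfl⟩
  have hmx : ∀ x, Measurable fun y => h (x + y) := fun x => hm.comp (measurable_const_add x)
  have hc : ∀ j, Continuous (scaledSmooth h a j) := fun j =>
    continuous_iff_continuousAt.2 fun x => (hasDerivAt_scaledSmooth hm h1 a j x).continuousAt
  induction j generalizing x with
  | zero =>
    rw [scaledSmooth_zero hm hb (v := w + v) (by push_cast; rw [hv, hw])]
    simp_rw [scaledSmooth_zero hm ha hv, add_assoc]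
    rw [← integral_conv (f := fun y => h (x + y))
      (integrable_of_measurable_of_abs_le_one (hmx x) (fun _ => h1 _) _),
      gaussianReal_conv_gaussianReal, add_zero]
  | succ j ih =>
    obtain ⟨B, hB⟩ := exists_abs_scaledSmooth_le (j + 1)
    have hint : ∀ x, Continuous fun u => scaledSmooth h a j (x + u) := fun x =>
      (hc j).comp (continuous_const_add x)
    obtain ⟨B', hB'⟩ := exists_abs_scaledSmooth_le j
    have hd := (hasDerivAt_integral_of_dominated_loc_of_deriv_le (μ := gaussianReal 0 w)
      (F := fun x u => scaledSmooth h a j (x + u))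
      (F' := fun x u => scaledSmooth h a (j + 1) (x + u)) (x₀ := x)
      (bound := fun _ => B / a ^ (j + 1)) Filter.univ_mem
      (.of_forall fun x => (hint x).aestronglyMeasurable)
      (integrable_of_continuous_of_abs_le (hint x) (fun u => hB' h h1 a ha (x + u)) _)
      ((hc (j + 1)).comp (continuous_const_add x)).aestronglyMeasurable
      (.of_forall fun u z _ => hB h h1 a ha (z + u)) (integrable_const _)
      (.of_forall fun u z _ => (hasDerivAt_scaledSmooth hm h1 a j (z + u)).comp_add_const z u)).2
    rw [funext ih] at hd
    exact hd.unique (hasDerivAt_scaledSmooth hm h1 b j x)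

end ScaledSmoothing

section Edgeworth

theorem integral_pi_eq_integral_scaledSmooth {h : ℝ → ℝ} (hm : Measurable h)
    (h1 : ∀ x, |h x| ≤ 1) (α : Measure ℝ) [IsProbabilityMeasure α] (m : ℝ) {v : ℝ≥0} {n : ℕ}
    {a : ℝ} (ha : 0 < a) (hv : ((n * v : ℝ≥0) : ℝ) = a ^ 2) :
    ∫ ω, h (∑ i, (ω i - m)) ∂(Measure.pi fun _ : Fin n => α ∗ gaussianReal m v)
      = ∫ x, scaledSmooth h a 0 x ∂(convPow α n) := by
  have hm' : Measurable fun x => h (x - n * m) := hm.comp (measurable_id.sub_const _)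
  have hsum : ∀ ω : Fin n → ℝ, ∑ i, (ω i - m) = ∑ i, ω i - n * m := by simp
  simp_rw [hsum]
  rw [← integral_map (φ := fun ω : Fin n → ℝ => ∑ i, ω i) (f := fun x => h (x - n * m))
    (by fun_prop) hm'.aestronglyMeasurable, map_sum_pi_conv_gaussianReal,
    integral_conv (integrable_of_measurable_of_abs_le_one hm' (fun _ => h1 _) _)]
  refine integral_congr_ae (.of_forall fun x => ?_)
  have hg : gaussianReal (n * m) (n * v) = (gaussianReal 0 (n * v)).map (· + n * m) := by
    rw [gaussianReal_map_add_const, zero_add]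
  simp only [hg]
  rw [scaledSmooth_zero hm ha hv, integral_map (f := fun y => h (x + y - n * m))
    (by fun_prop) (hm'.comp (measurable_const_add x)).aestronglyMeasurable]
  congr 1 with y
  congr 1
  ring

/-- **Second-order Edgeworth expansion** in total variation for i.i.d. sums whose common law has a
Gaussian factor. -/
theorem exists_abs_integral_pi_conv_gaussianReal_sub_le (α : Measure ℝ) [IsProbabilityMeasure α]
    (hα : ∀ k : ℕ, Integrable (fun x => x ^ k) α) (hα1 : ∫ x, x ∂α = 0) (m : ℝ) {v : ℝ≥0}
    {s σ : ℝ} (hs : 0 < s) (hv : (v : ℝ) = s ^ 2) (hσ : 0 < σ)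
    (hvar : ∫ x, x ^ 2 ∂α + s ^ 2 = σ ^ 2) :
    ∃ C : ℝ, ∀ n : ℕ, 1 ≤ n → ∀ h : ℝ → ℝ, Measurable h → (∀ x, |h x| ≤ 1) →
      |(∫ ω, h ((∑ i, (ω i - m)) / (σ * Real.sqrt n))
            ∂(Measure.pi fun _ : Fin n => α ∗ gaussianReal m v)) -
          (∫ z, h z ∂(gaussianReal 0 1)) -
          (∫ x, x ^ 3 ∂α) / (6 * σ ^ 3 * Real.sqrt n) *
            ∫ z, (z ^ 3 - 3 * z) * h z ∂(gaussianReal 0 1)|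
        ≤ C / n := by
  obtain ⟨w, hw⟩ : ∃ w : ℝ≥0, (w : ℝ) = ∫ x, x ^ 2 ∂α :=
    ⟨⟨_, integral_nonneg fun x => sq_nonneg x⟩, rfl⟩
  set β := gaussianReal 0 w with hβdef
  have hβ : ∀ k : ℕ, Integrable (fun x => x ^ k) β := integrable_pow_gaussianReal 0 w
  have hβ1 : ∫ x, x ∂β = 0 := integral_id_gaussianReal
  have hβ2 : ∫ x, x ^ 2 ∂β = w := by simpa using integral_sub_sq_gaussianReal 0 w
  have hβ3 : ∫ x, x ^ 3 ∂β = 0 := by simpa using integral_sub_cube_gaussianReal 0 w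
  choose B hB using exists_abs_scaledSmooth_le
  set c := (∫ x, x ^ 3 ∂α) / 6 with hc
  refine ⟨B 4 / s ^ 4 * (∫ x, |x| ^ 4 ∂α + ∫ x, |x| ^ 4 ∂β)
    + |c| * (B 6 / s ^ 6 * (∫ x, |x| ^ 3 ∂α + ∫ x, |x| ^ 3 ∂β) + B 4 / s ^ 4 * ∫ x, |x| ∂β),
    fun n hn h hm h1 => ?_⟩
  have hn0 : (0 : ℝ) < n := by exact_mod_cast hn
  have hr : Real.sqrt n ^ 2 = n := Real.sq_sqrt hn0.le
  have hr0 : 0 < Real.sqrt n := Real.sqrt_pos.2 hn0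
  set r := Real.sqrt n with hrdef
  have ha : 0 < s * r := mul_pos hs hr0
  have hb : 0 < σ * r := mul_pos hσ hr0
  set g : ℝ → ℝ := fun x => h (x / (σ * r)) with hg
  have hgm : Measurable g := hm.comp (measurable_id.div_const _)
  have hg1 : ∀ x, |g x| ≤ 1 := fun x => h1 _
  have hgb : (fun t => g (σ * r * t)) = h := by
    ext t
    simp only [hg]
    rw [mul_div_cancel_left₀ _ hb.ne']
  have hvn : ((n * v : ℝ≥0) : ℝ) = (s * r) ^ 2 := by
    push_cast
    rw [hv, mul_pow, hr, mul_comm]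
  have hwn : ((n * w : ℝ≥0) : ℝ) + (s * r) ^ 2 = (σ * r) ^ 2 := by
    push_cast
    rw [mul_pow, mul_pow, hr, hw, ← hvar]
    ring
  have hsmooth : ∀ j, ∫ x, scaledSmooth g (s * r) j x ∂(convPow β n)
      = (∫ z, (realHermite j).eval z * h z ∂(gaussianReal 0 1)) / (σ * r) ^ j := by
    intro j
    have := integral_scaledSmooth_add hgm hg1 ha hb hwn j 0
    simp only [zero_add] at this
    rw [hβdef, convPow_gaussianReal, this, scaledSmooth, hgb, zero_div, gaussSmooth_zero_right]
  have hmain := abs_integral_convPow_conv_sub_sub_le hα hβ (hα1.trans hβ1.symm)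
    (hw.symm.trans hβ2.symm) hβ3 (fun j => hasDerivAt_scaledSmooth hgm hg1 (s * r) j)
    (fun j => hB j g hg1 (s * r) ha) n 0
  simp only [add_zero] at hmain
  rw [show convPow β 0 = Measure.dirac 0 from rfl, Measure.conv_dirac_zero, hsmooth, hsmooth,
    ← integral_pi_eq_integral_scaledSmooth hgm hg1 α m ha hvn, ← hc] at hmain
  simp only [realHermite_zero, Polynomial.eval_one, one_mul, pow_zero, div_one,
    eval_realHermite_three] at hmain
  have hpow4 : (s * r) ^ 4 = s ^ 4 * n ^ 2 := by rw [mul_pow, ← hr]; ring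
  have hpow6 : (s * r) ^ 6 = s ^ 6 * n ^ 3 := by rw [mul_pow, ← hr]; ring
  have hcoef : ∀ I : ℝ, (∫ x, x ^ 3 ∂α) / (6 * σ ^ 3 * r) * I = n * (c * (I / (σ * r) ^ 3)) := by
    intro I
    rw [hc, ← hr]
    field_simp
  rw [hcoef]
  refine hmain.trans_eq ?_
  rw [hpow4, hpow6]
  field_simp

end Edgeworth

section Mixture

theorem integral_conv_gaussianReal_moments {α : Measure ℝ} [IsProbabilityMeasure α]
    (hα : ∀ k : ℕ, Integrable (fun x => x ^ k) α) {m : ℝ} {v : ℝ≥0}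
    (hν : ∀ k : ℕ, Integrable (fun x => (x - m) ^ k) (α ∗ gaussianReal m v)) :
    ∫ x, (x - m) ∂(α ∗ gaussianReal m v) = ∫ x, x ∂α ∧
    ∫ x, (x - m) ^ 2 ∂(α ∗ gaussianReal m v) = ∫ x, x ^ 2 ∂α + v ∧
    ∫ x, (x - m) ^ 3 ∂(α ∗ gaussianReal m v) = ∫ x, x ^ 3 ∂α + 3 * v * ∫ x, x ∂α := by
  have hg := integrable_sub_pow_gaussianReal m m v
  have hg1 : Integrable (fun x => x - m) (gaussianReal m v) := by simpa using hg 1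
  have hα1 : Integrable (fun x => x) α := by simpa using hα 1
  refine ⟨?_, ?_, ?_⟩
  · rw [integral_conv (by simpa using hν 1)]
    congr 1 with x
    simp_rw [add_sub_assoc]
    rw [integral_add (integrable_const _) hg1, integral_sub_gaussianReal]
    simp
  · rw [integral_conv (hν 2)]
    have h : ∀ x, ∫ y, (x + y - m) ^ 2 ∂gaussianReal m v = x ^ 2 + v := by
      intro x
      have he : ∀ y, (x + y - m) ^ 2 = x ^ 2 + 2 * x * (y - m) + (y - m) ^ 2 := fun y => by ring
      simp_rw [he]
      have i1 : Integrable (fun y => x ^ 2 + 2 * x * (y - m)) (gaussianReal m v) :=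
        (integrable_const _).add (hg1.const_mul _)
      rw [integral_add i1 (hg 2),
        integral_add (integrable_const _) (hg1.const_mul _), integral_const_mul,
        integral_sub_gaussianReal, integral_sub_sq_gaussianReal]
      simp
    simp_rw [h]
    rw [integral_add (hα 2) (integrable_const _)]
    simp
  · rw [integral_conv (hν 3)]
    have h : ∀ x, ∫ y, (x + y - m) ^ 3 ∂gaussianReal m v = x ^ 3 + 3 * v * x := by
      intro x
      have he : ∀ y, (x + y - m) ^ 3
          = x ^ 3 + 3 * x ^ 2 * (y - m) + 3 * x * (y - m) ^ 2 + (y - m) ^ 3 := fun y => by ring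
      simp_rw [he]
      have i1 : Integrable (fun y => x ^ 3 + 3 * x ^ 2 * (y - m)) (gaussianReal m v) :=
        (integrable_const _).add (hg1.const_mul _)
      have i2 : Integrable (fun y => x ^ 3 + 3 * x ^ 2 * (y - m) + 3 * x * (y - m) ^ 2)
          (gaussianReal m v) := i1.add ((hg 2).const_mul _)
      rw [integral_add i2 (hg 3), integral_add i1 ((hg 2).const_mul _),
        integral_add (integrable_const _) (hg1.const_mul _), integral_const_mul,
        integral_const_mul, integral_sub_gaussianReal, integral_sub_sq_gaussianReal,
        integral_sub_cube_gaussianReal]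
      simp only [integral_const, probReal_univ, smul_eq_mul, one_mul, mul_zero, add_zero]
      ring
    simp_rw [h]
    rw [integral_add (hα 3) (hα1.const_mul _), integral_const_mul]

theorem gaussDensity_eq_gaussianPDFReal (μ s : ℝ) (x : ℝ) :
    gaussDensity μ s x = gaussianPDFReal μ (Real.toNNReal (s ^ 2)) x := by
  rw [gaussDensity, gaussianPDFReal, Real.coe_toNNReal _ (sq_nonneg s)]

theorem withDensity_mixture {p : ℝ} (hp0 : 0 ≤ p) (hp1 : p ≤ 1) (μ₁ μ₂ : ℝ) {s₁ s₂ : ℝ}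
    (hs₁ : 0 < s₁) (hs₂ : 0 < s₂) :
    volume.withDensity
      (fun x => ENNReal.ofReal (p * gaussDensity μ₁ s₁ x + (1 - p) * gaussDensity μ₂ s₂ x))
    = ENNReal.ofReal p • gaussianReal μ₁ (Real.toNNReal (s₁ ^ 2))
      + ENNReal.ofReal (1 - p) • gaussianReal μ₂ (Real.toNNReal (s₂ ^ 2)) := by
  have hpos : ∀ {s : ℝ}, 0 < s → Real.toNNReal (s ^ 2) ≠ 0 := fun hs =>
    (Real.toNNReal_pos.2 (pow_pos hs 2)).ne'
  have h1p : 0 ≤ 1 - p := sub_nonneg.2 hp1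
  have h : (fun x => ENNReal.ofReal (p * gaussDensity μ₁ s₁ x + (1 - p) * gaussDensity μ₂ s₂ x))
      = ENNReal.ofReal p • gaussianPDF μ₁ (Real.toNNReal (s₁ ^ 2))
        + ENNReal.ofReal (1 - p) • gaussianPDF μ₂ (Real.toNNReal (s₂ ^ 2)) := by
    ext x
    simp only [gaussDensity_eq_gaussianPDFReal, Pi.add_apply, Pi.smul_apply, smul_eq_mul,
      gaussianPDF]
    rw [ENNReal.ofReal_add (mul_nonneg hp0 (gaussianPDFReal_nonneg _ _ _))
      (mul_nonneg h1p (gaussianPDFReal_nonneg _ _ _)), ENNReal.ofReal_mul hp0,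
      ENNReal.ofReal_mul h1p]
  rw [h, withDensity_add_left ((measurable_gaussianPDF _ _).const_smul _),
    withDensity_smul _ (measurable_gaussianPDF _ _),
    withDensity_smul _ (measurable_gaussianPDF _ _),
    gaussianReal_of_var_ne_zero _ (hpos hs₁), gaussianReal_of_var_ne_zero _ (hpos hs₂)]

theorem integrable_sub_pow_mixture (c p q μ₁ μ₂ : ℝ) (v₁ v₂ : ℝ≥0) (k : ℕ) :
    Integrable (fun x => (x - c) ^ k) (ENNReal.ofReal p • gaussianReal μ₁ v₁
      + ENNReal.ofReal q • gaussianReal μ₂ v₂) :=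
  ((integrable_sub_pow_gaussianReal c μ₁ v₁ k).smul_measure ENNReal.ofReal_ne_top).add_measure
    ((integrable_sub_pow_gaussianReal c μ₂ v₂ k).smul_measure ENNReal.ofReal_ne_top)

theorem mixture_conv_gaussianReal (p q μ₁ μ₂ m : ℝ) (v₁ v₂ v : ℝ≥0) :
    (ENNReal.ofReal p • gaussianReal μ₁ v₁ + ENNReal.ofReal q • gaussianReal μ₂ v₂)
        ∗ gaussianReal m v
      = ENNReal.ofReal p • gaussianReal (μ₁ + m) (v₁ + v)
        + ENNReal.ofReal q • gaussianReal (μ₂ + m) (v₂ + v) := by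
  have := Measure.smul_finite (gaussianReal μ₁ v₁) (ENNReal.ofReal_ne_top (r := p))
  have := Measure.smul_finite (gaussianReal μ₂ v₂) (ENNReal.ofReal_ne_top (r := q))
  rw [Measure.add_conv, Measure.conv_smul_left, Measure.conv_smul_left,
    gaussianReal_conv_gaussianReal, gaussianReal_conv_gaussianReal]

end Mixture

/-- **Two-term Edgeworth expansion for sums of i.i.d. two-component Gaussian mixtures.**
Let `Y₁, …, Yₙ` be i.i.d. with the two-component Gaussian mixture law `ν` of density
`p φ₁ + (1 - p) φ₂`, where `φᵢ` is the density of `N(μᵢ, σᵢ²)` and `0 ≤ p ≤ 1`.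
Let `m = E[Y₁]`, `σ² = Var(Y₁) > 0`, `κ₃ = E[(Y₁ - m)³]` and
`W = (1/(σ√n)) ∑ (Yᵢ - m)`. Then the two-term Edgeworth expansion holds for all test
functions bounded by `1`, with error rate `C / n` where `C` depends only on
`p, μ₁, σ₁², μ₂, σ₂²` and not on `n`. -/
theorem gaussian_mixture_edgeworth
    (p : ℝ) (hp0 : 0 ≤ p) (hp1 : p ≤ 1)
    (μ₁ μ₂ σ₁ σ₂ : ℝ) (hσ₁ : 0 < σ₁) (hσ₂ : 0 < σ₂)
    (ν : Measure ℝ) [IsProbabilityMeasure ν]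
    (hν : ν = volume.withDensity
      (fun x => ENNReal.ofReal (p * gaussDensity μ₁ σ₁ x + (1 - p) * gaussDensity μ₂ σ₂ x)))
    (m σ κ₃ : ℝ) (hm : m = ∫ x, x ∂ν) (hσpos : 0 < σ)
    (hσ : σ ^ 2 = ∫ x, (x - m) ^ 2 ∂ν) (hκ₃ : κ₃ = ∫ x, (x - m) ^ 3 ∂ν) :
    ∃ C : ℝ, ∀ n : ℕ, 1 ≤ n →
      ∀ h : ℝ → ℝ, Measurable h → (∀ x, |h x| ≤ 1) →
      |(∫ ω, h ((∑ i, (ω i - m)) / (σ * Real.sqrt n)) ∂(Measure.pi fun _ : Fin n => ν)) -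
          (∫ z, h z ∂(gaussianReal 0 1)) -
          κ₃ / (6 * σ ^ 3 * Real.sqrt n) * ∫ z, (z ^ 3 - 3 * z) * h z ∂(gaussianReal 0 1)|
        ≤ C / n := by
  have hmix := withDensity_mixture hp0 hp1 μ₁ μ₂ hσ₁ hσ₂
  set v₁ := Real.toNNReal (σ₁ ^ 2) with hv₁
  set v₂ := Real.toNNReal (σ₂ ^ 2) with hv₂
  set v := min v₁ v₂ with hv
  have hv0 : 0 < v :=
    lt_min (Real.toNNReal_pos.2 (pow_pos hσ₁ 2)) (Real.toNNReal_pos.2 (pow_pos hσ₂ 2))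
  set α : Measure ℝ := ENNReal.ofReal p • gaussianReal (μ₁ - m) (v₁ - v)
    + ENNReal.ofReal (1 - p) • gaussianReal (μ₂ - m) (v₂ - v) with hαdef
  have hα : IsProbabilityMeasure α := ⟨by
    simp only [hαdef, Measure.add_apply, Measure.smul_apply, measure_univ, smul_eq_mul, mul_one]
    rw [← ENNReal.ofReal_add hp0 (sub_nonneg.2 hp1)]
    simp⟩
  have hνα : ν = α ∗ gaussianReal m v := by
    rw [hν, hmix, hαdef, mixture_conv_gaussianReal, sub_add_cancel, sub_add_cancel,
      tsub_add_cancel_of_le (min_le_left v₁ v₂), tsub_add_cancel_of_le (min_le_right v₁ v₂)]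
  have hνint : ∀ k : ℕ, Integrable (fun x => (x - m) ^ k) ν := fun k => by
    rw [hν, hmix]
    exact integrable_sub_pow_mixture m p (1 - p) μ₁ μ₂ v₁ v₂ k
  have hαint : ∀ k : ℕ, Integrable (fun x => x ^ k) α := fun k => by
    simpa only [sub_zero] using
      integrable_sub_pow_mixture 0 p (1 - p) (μ₁ - m) (μ₂ - m) (v₁ - v) (v₂ - v) k
  obtain ⟨e1, e2, e3⟩ := integral_conv_gaussianReal_moments hαint (m := m) (v := v)
    (fun k => hνα ▸ hνint k)
  rw [← hνα] at e1 e2 e3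
  have hν1 : Integrable (fun x => x) ν := by
    have h := (hνint 1).add (integrable_const m)
    simpa [Pi.add_def] using h
  rw [integral_sub hν1 (integrable_const m), ← hm, integral_const, probReal_univ, one_smul,
    sub_self] at e1
  rw [← e1, mul_zero, add_zero, ← hκ₃] at e3
  rw [← hσ] at e2
  have hsq : (v : ℝ) = Real.sqrt v ^ 2 := (Real.sq_sqrt v.coe_nonneg).symm
  rw [hνα, e3]
  exact exists_abs_integral_pi_conv_gaussianReal_sub_le α hαint e1.symm m
    (Real.sqrt_pos.2 hv0) hsq hσpos (e2.trans (congrArg _ hsq)).symm
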